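/- Let n = n1 + n2 with n1, n2 ≥ 1, and let G be the complete split graph with clique V1 = {1,…,n1} and independent set V2 = {n1+1,…,n}. Let x ∈ ℝ^n satisfy 1 > x_1 ≥ x_2 ≥ … ≥ x_{n1} > 0 and 1 > x_{n1+1} ≥ x_{n1+2} ≥ … ≥ x_n > 0, and set X_j = [0, x_j) for j ∈ V2. Then there exist Lebesgue-measurable sets X_i ⊆ [0,1) for i ∈ V1 with μ(X_i) = x_i, a set S ⊆ V2 with |S| ≤ n1 − 1, and an integer α with 0 ≤ α ≤ n1 − 1, such that: (a) μ(X_i ∩ X_j) = max{0, x_i + x_j − 1} for all i ∈ V1 and j ∈ V2 ∖ S; and (b) for every t ∈ [0,1), the number of indices i ∈ V1 ∪ S with t ∈ X_i is either α or α + 1. -/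

import Mathlib

open Finset MeasureTheory

/-- Filling the cells `k`, of length `l k` and initial height `c k`, with masses `x i` of density at
most one so as to minimise the integral of the squared total height: at the minimum no mass can be
moved from a cell to a strictly lower one. -/
lemma exists_balanced_fractions {ι κ : Type*} [DecidableEq ι] [DecidableEq κ]
    (I : Finset ι) (K : Finset κ) (l c : κ → ℝ) (x : ι → ℝ)
    (hx : ∀ i ∈ I, 0 ≤ x i ∧ x i ≤ 1) (hl : ∑ k ∈ K, l k = 1) :
    ∃ g : ι → κ → ℝ, (∀ i k, 0 ≤ g i k ∧ g i k ≤ 1) ∧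
      (∀ i ∈ I, ∑ k ∈ K, l k * g i k = x i) ∧
      ∀ i ∈ I, ∀ k ∈ K, ∀ k' ∈ K, 0 < l k → 0 < l k' → g i k < 1 → 0 < g i k' →
        ∑ j ∈ I, g j k' + c k' ≤ ∑ j ∈ I, g j k + c k := by
  let D : Set (ι → κ → ℝ) := Set.Icc 0 1 ∩ {g | ∀ i ∈ I, ∑ k ∈ K, l k * g i k = x i}
  let F : (ι → κ → ℝ) → ℝ := fun g =>
    ∑ k ∈ K, l k * ((∑ j ∈ I, g j k) ^ 2 / 2 + c k * ∑ j ∈ I, g j k)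
  have hDc : IsCompact D := by
    refine isCompact_Icc.inter_right ?_
    simp only [Set.ofPred_forall]
    refine isClosed_biInter fun i _ => isClosed_eq ?_ continuous_const
    fun_prop
  have hF : Continuous F := by fun_prop
  have hDn : D.Nonempty := by
    refine ⟨fun i _ => if i ∈ I then x i else 0, ⟨fun i k => ?_, fun i k => ?_⟩, fun i hi => ?_⟩
    · by_cases hi : i ∈ I <;> simp [hi, hx]
    · by_cases hi : i ∈ I <;> simp [hi, hx]
    · simp [hi, ← Finset.sum_mul, hl]
  obtain ⟨g, ⟨⟨hg0, hg1⟩, hgx⟩, hmin⟩ := hDc.exists_isMinOn hDn hF.continuousOn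
  refine ⟨g, fun i k => ⟨hg0 i k, hg1 i k⟩, hgx, fun i hi k hk k' hk' hlk hlk' hgk hgk' => ?_⟩
  by_contra! hlt
  have hne : k ≠ k' := by rintro rfl; exact lt_irrefl _ hlt
  set d := (∑ j ∈ I, g j k' + c k') - (∑ j ∈ I, g j k + c k) with hd
  have hdpos : 0 < d := sub_pos.2 hlt
  obtain ⟨δ, hδ, h1, h2, h3⟩ : ∃ δ : ℝ, 0 < δ ∧ δ * l k' ≤ 1 - g i k ∧ δ * l k ≤ g i k' ∧
      δ * (l k + l k') ≤ d := by
    refine ⟨min (min ((1 - g i k) / l k') (g i k' / l k)) (d / (l k + l k')), ?_, ?_, ?_, ?_⟩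
    · have := sub_pos.2 hgk
      positivity
    · rw [← le_div_iff₀ hlk']; exact (min_le_left _ _).trans (min_le_left _ _)
    · rw [← le_div_iff₀ hlk]; exact (min_le_left _ _).trans (min_le_right _ _)
    · rw [← le_div_iff₀ (by positivity)]; exact min_le_right _ _
  let e : κ → ℝ := fun q => (if q = k then l k' else 0) - (if q = k' then l k else 0)
  let g' : ι → κ → ℝ := fun j q => g j q + if j = i then δ * e q else 0
  have hsum : ∀ q, ∑ j ∈ I, g' j q = ∑ j ∈ I, g j q + δ * e q := by
    intro q
    simp [g', Finset.sum_add_distrib, hi]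
  have hb : 0 < δ * l k ∧ 0 < δ * l k' := ⟨by positivity, by positivity⟩
  have hbd : ∀ j q, 0 ≤ g' j q ∧ g' j q ≤ 1 := by
    intro j q
    have a0 : 0 ≤ g j q := hg0 j q
    have a1 : g j q ≤ 1 := hg1 j q
    by_cases hj : j = i
    · subst hj
      by_cases hq : q = k
      · subst hq; simp only [g', e, if_true, hne, if_false]
        constructor <;> nlinarith
      · by_cases hq' : q = k'
        · subst hq'; simp only [g', e, if_true, hq, if_false]
          constructor <;> nlinarith
        · simp [g', e, hq, hq', a0, a1]
    · simp [g', hj, a0, a1]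
  have hmem : g' ∈ D := by
    refine ⟨⟨fun j q => (hbd j q).1, fun j q => (hbd j q).2⟩, fun j hj => ?_⟩
    by_cases hji : j = i
    · subst hji
      simp only [g', e, if_true, mul_add, mul_sub, Finset.sum_add_distrib,
        Finset.sum_sub_distrib, hgx j hj, mul_ite, mul_zero, Finset.sum_ite_eq', hk, hk']
      ring
    · simp [g', hji, hgx j hj]
  have hle : F g ≤ F g' := hmin hmem
  have hdiff : F g' - F g = δ * (l k * l k') * (-d + δ * (l k + l k') / 2) := by
    have : ∀ q, l q * ((∑ j ∈ I, g' j q) ^ 2 / 2 + c q * ∑ j ∈ I, g' j q) -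
        l q * ((∑ j ∈ I, g j q) ^ 2 / 2 + c q * ∑ j ∈ I, g j q) =
        (if q = k then δ * (l k * l k') * ((∑ j ∈ I, g j k + c k) + δ * l k' / 2) else 0) +
        (if q = k' then δ * (l k * l k') * (-(∑ j ∈ I, g j k' + c k') + δ * l k / 2) else 0) := by
      intro q
      rw [hsum]
      by_cases hq : q = k
      · subst hq; simp only [e, if_true, hne, if_false]; ring
      · by_cases hq' : q = k'
        · subst hq'; simp only [e, if_true, hq, if_false]; ring
        · simp [e, hq, hq']
    simp only [F]
    rw [← Finset.sum_sub_distrib, Finset.sum_congr rfl fun q _ => this q, Finset.sum_add_distrib]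
    simp only [Finset.sum_ite_eq', hk, hk', if_true, hd]
    ring
  have : δ * (l k * l k') * (-d + δ * (l k + l k') / 2) < 0 :=
    mul_neg_of_pos_of_neg (by positivity) (by linarith)
  linarith

/-- The set obtained by placing an arc of relative length `g`, starting at relative position `P`
modulo one, in the interval `[a, a + l)` viewed as a circle. -/
def arcSet (a l P g : ℝ) : Set ℝ :=
  {t ∈ Set.Ico a (a + l) | ⌈P - (t - a) / l⌉ < ⌈P + g - (t - a) / l⌉}

lemma arcSet_subset (a l P g : ℝ) : arcSet a l P g ⊆ Set.Ico a (a + l) := fun _ h => h.1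

lemma measurableSet_arcSet (a l P g : ℝ) : MeasurableSet (arcSet a l P g) := by
  have h : MeasurableSet {t : ℝ | ⌈P - (t - a) / l⌉ < ⌈P + g - (t - a) / l⌉} := by
    refine measurableSet_lt ?_ ?_
    · exact Int.measurable_ceil.comp (by fun_prop)
    · exact Int.measurable_ceil.comp (by fun_prop)
  exact measurableSet_Ico.inter h

lemma arcSet_eq {a l P g : ℝ} (hl : 0 < l) (hg1 : g ≤ 1) :
    arcSet a l P g = if Int.fract P + g ≤ 1 then
        Set.Ico (a + l * Int.fract P) (a + l * (Int.fract P + g))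
      else Set.Ico a (a + l * (Int.fract P + g - 1)) ∪ Set.Ico (a + l * Int.fract P) (a + l) := by
  ext t
  obtain ⟨u, rfl⟩ : ∃ u, t = a + l * u := ⟨(t - a) / l, by field_simp; ring⟩
  have hu : (a + l * u - a) / l = u := by field_simp; ring
  have hP : P = Int.fract P + ⌊P⌋ := (Int.fract_add_floor P).symm
  have hf0 := Int.fract_nonneg P
  have hf1 := Int.fract_lt_one P
  have e1 : ⌈P - u⌉ = ⌈Int.fract P - u⌉ + ⌊P⌋ := by
    rw [← Int.ceil_add_intCast]; congr 1; linarith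
  have e2 : ⌈P + g - u⌉ = ⌈Int.fract P + g - u⌉ + ⌊P⌋ := by
    rw [← Int.ceil_add_intCast]; congr 1; linarith
  have hlt : ∀ p q : ℝ, a + l * p < a + l * q ↔ p < q := by
    intro p q; rw [add_lt_add_iff_left, mul_lt_mul_iff_right₀ hl]
  have hle : ∀ p q : ℝ, a + l * p ≤ a + l * q ↔ p ≤ q := by
    intro p q; rw [add_le_add_iff_left, mul_le_mul_iff_right₀ hl]
  have hl0 : ∀ q : ℝ, a ≤ a + l * q ↔ 0 ≤ q := by
    intro q; have := hle 0 q; simpa using this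
  have hl1 : ∀ q : ℝ, a + l * q < a + l ↔ q < 1 := by
    intro q; have := hlt q 1; simpa using this
  simp only [arcSet, Set.mem_ofPred_eq, hu, e1, e2, add_lt_add_iff_right]
  generalize Int.fract P = f at *
  have key : ∀ u : ℝ, 0 ≤ u → u < 1 → (⌈f - u⌉ < ⌈f + g - u⌉ ↔
      (f ≤ u ∧ u < f + g) ∨ u < f + g - 1) := by
    intro u hu0 hu1
    rcases le_or_gt f u with h | h
    · have c1 : ⌈f - u⌉ = 0 := Int.ceil_eq_iff.2 ⟨by push_cast; linarith, by push_cast; linarith⟩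
      rw [c1, Int.lt_ceil]
      push_cast
      constructor
      · intro h'; left; constructor <;> linarith
      · rintro (h' | h') <;> linarith [h']
    · have c1 : ⌈f - u⌉ = 1 := Int.ceil_eq_iff.2 ⟨by push_cast; linarith, by push_cast; linarith⟩
      rw [c1, Int.lt_ceil]
      push_cast
      constructor
      · intro h'; right; linarith
      · rintro (h' | h') <;> linarith
  split_ifs with h
  · simp only [Set.mem_Ico, hlt, hle, hl0, hl1]
    constructor
    · rintro ⟨⟨h0, h1⟩, h2⟩
      rcases (key u h0 h1).1 h2 with h3 | h3
      · exact h3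
      · linarith
    · rintro ⟨h1, h2⟩
      have h0 : 0 ≤ u := by linarith
      have h1' : u < 1 := by linarith
      exact ⟨⟨h0, h1'⟩, (key u h0 h1').2 (Or.inl ⟨h1, h2⟩)⟩
  · simp only [Set.mem_Ico, Set.mem_union, hlt, hle, hl0, hl1]
    push Not at h
    constructor
    · rintro ⟨⟨h0, h1⟩, h2⟩
      rcases (key u h0 h1).1 h2 with h3 | h3
      · exact Or.inr ⟨h3.1, h1⟩
      · exact Or.inl ⟨h0, h3⟩
    · rintro (⟨h1, h2⟩ | ⟨h1, h2⟩)
      · have h1' : u < 1 := by linarith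
        exact ⟨⟨h1, h1'⟩, (key u h1 h1').2 (Or.inr h2)⟩
      · have h0 : 0 ≤ u := by linarith
        exact ⟨⟨h0, h2⟩, (key u h0 h2).2 (Or.inl ⟨h1, by linarith⟩)⟩

lemma volume_real_arcSet {a l P g : ℝ} (hl : 0 ≤ l) (hg0 : 0 ≤ g) (hg1 : g ≤ 1) :
    volume.real (arcSet a l P g) = l * g := by
  rcases hl.eq_or_lt with rfl | hl
  · have : arcSet a 0 P g = ∅ := by
      simpa using arcSet_subset a 0 P g
    simp [this]
  have hf0 := Int.fract_nonneg P
  have hf1 := Int.fract_lt_one P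
  rw [arcSet_eq hl hg1]
  split_ifs with h
  · rw [Real.volume_real_Ico_of_le (by nlinarith)]; ring
  · push Not at h
    rw [measureReal_union ?_ measurableSet_Ico (by simp) (by simp), Real.volume_real_Ico_of_le (by nlinarith),
      Real.volume_real_Ico_of_le (by nlinarith)]
    · ring
    · rw [Set.disjoint_left]
      rintro t ⟨_, h1⟩ ⟨h2, _⟩
      nlinarith

open Classical in
lemma card_filter_mem_arcSet {a l t : ℝ} (g : ℕ → ℝ) (hg : ∀ i, 0 ≤ g i ∧ g i ≤ 1)
    (ht : t ∈ Set.Ico a (a + l)) (n : ℕ) :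
    (((range n).filter fun i => t ∈ arcSet a l (∑ j ∈ range i, g j) (g i)).card : ℤ) =
      ⌈∑ j ∈ range n, g j - (t - a) / l⌉ := by
  have hl : 0 < l := by linarith [ht.1, ht.2]
  have hu0 : 0 ≤ (t - a) / l := div_nonneg (by linarith [ht.1]) hl.le
  have hu1 : (t - a) / l < 1 := by rw [div_lt_one hl]; linarith [ht.2]
  induction n with
  | zero =>
    symm
    simp only [range_zero, sum_empty, filter_empty, card_empty, Nat.cast_zero]
    exact Int.ceil_eq_iff.2 ⟨by push_cast; linarith, by push_cast; linarith⟩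
  | succ n ih =>
    rw [range_add_one, filter_insert, sum_insert (by simp), add_comm (g n)]
    have h0 : ⌈∑ j ∈ range n, g j - (t - a) / l⌉ ≤ ⌈∑ j ∈ range n, g j + g n - (t - a) / l⌉ :=
      Int.ceil_le_ceil (by linarith [(hg n).1])
    have h1 : ⌈∑ j ∈ range n, g j + g n - (t - a) / l⌉ ≤
        ⌈∑ j ∈ range n, g j - (t - a) / l⌉ + 1 := by
      rw [← Int.ceil_add_one]
      exact Int.ceil_le_ceil (by linarith [(hg n).2])
    split_ifs with h
    · rw [card_insert_of_notMem (by simp)]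
      have := h.2
      push_cast
      omega
    · have : ¬ (⌈∑ j ∈ range n, g j - (t - a) / l⌉ < ⌈∑ j ∈ range n, g j + g n - (t - a) / l⌉) :=
        fun h' => h ⟨ht, h'⟩
      omega

/-- A monotone function with slope at most one on a finite set of naturals extends to `ℕ`. -/
lemma exists_slow_extension (K : Finset ℕ) (hK : K.Nonempty) (f : ℕ → ℕ)
    (hmono : ∀ a ∈ K, ∀ b ∈ K, a ≤ b → f a ≤ f b)
    (hlip : ∀ a ∈ K, ∀ b ∈ K, a ≤ b → f b ≤ f a + (b - a)) :
    ∃ p : ℕ → ℕ, (∀ a ∈ K, p a = f a) ∧ ∀ c, p c ≤ p (c + 1) ∧ p (c + 1) ≤ p c + 1 := by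
  refine ⟨fun c => K.inf' hK fun a => f a + (c - a), fun a ha => ?_, fun c => ⟨?_, ?_⟩⟩
  · apply le_antisymm
    · exact (Finset.inf'_le _ ha).trans (by simp)
    · refine Finset.le_inf' _ _ fun b hb => ?_
      rcases le_total a b with h | h
      · have := hmono a ha b hb h; omega
      · exact hlip b hb a ha h
  · refine Finset.le_inf' _ _ fun b hb => (Finset.inf'_le _ hb).trans (by omega)
  · obtain ⟨b, hb, h⟩ := Finset.exists_mem_eq_inf' hK fun a => f a + (c - a)
    simp only [h]
    exact (Finset.inf'_le _ hb).trans (by omega)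

/-- A balanced filling together with integer levels `p k` that lie within one below the total height
of the cell `k`, such that between cells of different levels every mass is either absent from the
later or saturated on the earlier one. -/
lemma exists_fractions_and_levels (n m : ℕ) (hn : 1 ≤ n) (l z : ℕ → ℝ)
    (hl : ∑ k ∈ range (m + 1), l k = 1) (hl0 : 0 < l 0) (hlm : 0 < l m)
    (hz : ∀ i < n, 0 ≤ z i ∧ z i ≤ 1) :
    ∃ (g : ℕ → ℕ → ℝ) (p : ℕ → ℕ), (∀ i k, 0 ≤ g i k ∧ g i k ≤ 1) ∧
      (∀ i < n, ∑ k ∈ range (m + 1), l k * g i k = z i) ∧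
      (∀ c, p c ≤ p (c + 1) ∧ p (c + 1) ≤ p c + 1) ∧ p 0 ≤ n - 1 ∧ m ≤ p m ∧
      (∀ k ≤ m, 0 < l k → (p k : ℝ) ≤ ∑ i ∈ range n, g i k + k ∧
        ∑ i ∈ range n, g i k + k ≤ p k + 1) ∧
      ∀ i < n, ∀ k' k, k' < k → k ≤ m → 0 < l k → 0 < l k' →
        g i k = 0 ∨ g i k' = 1 ∨ p k = p k' := by
  obtain ⟨g, hg, hgz, hopt⟩ := exists_balanced_fractions (range n) (range (m + 1)) l
    (fun k => (k : ℝ)) z (fun i hi => hz i (mem_range.1 hi)) hl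
  set G : ℕ → ℝ := fun k => ∑ i ∈ range n, g i k with hG
  have hG0 : ∀ k, 0 ≤ G k := fun k => Finset.sum_nonneg fun i _ => (hg i k).1
  have hGn : ∀ k, G k ≤ n := fun k => by
    simpa [hG] using Finset.sum_le_sum (s := range n) fun i _ => (hg i k).2
  have hopt' : ∀ i < n, ∀ k ≤ m, ∀ k' ≤ m, 0 < l k → 0 < l k' → g i k < 1 → 0 < g i k' →
      G k' + k' ≤ G k + k := fun i hi k hk k' hk' =>
    hopt i (mem_range.2 hi) k (by simp; omega) k' (by simp; omega)
  have hcase : ∀ k ≤ m, ∀ k' ≤ m, 0 < l k → 0 < l k' → G k' + k' ≤ G k + k ∨ G k' ≤ G k := by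
    intro k hk k' hk' hlk hlk'
    by_cases h : ∃ i < n, g i k < 1 ∧ 0 < g i k'
    · obtain ⟨i, hi, h1, h2⟩ := h
      exact Or.inl (hopt' i hi k hk k' hk' hlk hlk' h1 h2)
    · push Not at h
      refine Or.inr (Finset.sum_le_sum fun i hi => ?_)
      by_cases h1 : g i k < 1
      · exact (h i (mem_range.1 hi) h1).trans (hg i k).1
      · exact (hg i k').2.trans (not_lt.1 h1)
  have hmono : ∀ k' k, k' ≤ k → k ≤ m → 0 < l k' → 0 < l k → G k' + k' ≤ G k + k := by
    intro k' k hkk hk hlk' hlk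
    have hc : (k' : ℝ) ≤ k := by exact_mod_cast hkk
    rcases hcase k hk k' (by omega) hlk hlk' with h | h <;> linarith
  have hlip : ∀ k' k, k' ≤ k → k ≤ m → 0 < l k' → 0 < l k → G k ≤ G k' := by
    intro k' k hkk hk hlk' hlk
    have hc : (k' : ℝ) ≤ k := by exact_mod_cast hkk
    rcases hcase k' (by omega) k hk hlk' hlk with h | h <;> linarith
  have hH0 : ∀ k : ℕ, 0 ≤ G k + k := fun k => add_nonneg (hG0 k) k.cast_nonneg
  let f : ℕ → ℕ := fun k => min ⌊G k + k⌋₊ (n - 1 + k)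
  let K := (range (m + 1)).filter fun k => 0 < l k
  have hK : ∀ k, k ∈ K ↔ k ≤ m ∧ 0 < l k := fun k => by simp [K]
  obtain ⟨p, hpf, hp⟩ := exists_slow_extension K ⟨0, (hK 0).2 ⟨by omega, hl0⟩⟩ f
    (by
      intro a ha b hb hab
      rw [hK] at ha hb
      have := Nat.floor_le_floor (hmono a b hab hb.1 ha.2 hb.2)
      exact min_le_min this (by omega))
    (by
      intro a ha b hb hab
      rw [hK] at ha hb
      have h1 : G b + b ≤ G a + a + (b - a : ℕ) := by
        have := hlip a b hab hb.1 ha.2 hb.2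
        push_cast [hab]
        linarith
      have h2 := Nat.floor_le_floor h1
      rw [Nat.floor_add_natCast (hH0 a)] at h2
      simp only [f]
      omega)
  have hpmono : Monotone p := monotone_nat_of_le_succ fun c => (hp c).1
  refine ⟨g, p, hg, fun i hi => hgz i (mem_range.2 hi), hp, ?_, ?_, ?_, ?_⟩
  · rw [hpf 0 ((hK 0).2 ⟨by omega, hl0⟩)]
    exact (min_le_right _ _).trans (by omega)
  · rw [hpf m ((hK m).2 ⟨le_rfl, hlm⟩)]
    refine le_min (Nat.le_floor ?_) (by omega)
    linarith [hG0 m]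
  · intro k hk hlk
    rw [hpf k ((hK k).2 ⟨hk, hlk⟩)]
    constructor
    · exact le_trans (by exact_mod_cast min_le_left _ _) (Nat.floor_le (hH0 k))
    · rcases min_choice ⌊G k + k⌋₊ (n - 1 + k) with h | h
      · simp only [f, h]
        exact (Nat.lt_floor_add_one _).le
      · simp only [f, h]
        push_cast [hn]
        linarith [hGn k]
  · intro i hi k' k hkk hk hlk hlk'
    by_contra! hcon
    obtain ⟨h1, h2, h3⟩ := hcon
    have h1' : 0 < g i k := lt_of_le_of_ne (hg i k).1 (Ne.symm h1)
    have h2' : g i k' < 1 := lt_of_le_of_ne (hg i k').2 h2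
    have hH : G k + k = G k' + k' := le_antisymm
      (hopt' i hi k' (by omega) k hk hlk' hlk h2' h1') (hmono k' k hkk.le hk hlk' hlk)
    have hltn : G k' < n := by
      have : G k' < ∑ i ∈ range n, (1 : ℝ) :=
        Finset.sum_lt_sum (fun j _ => (hg j k').2) ⟨i, mem_range.2 hi, h2'⟩
      simpa using this
    have hcast : (n : ℝ) = (n - 1 : ℕ) + 1 := by push_cast [hn]; ring
    have hk'' : ⌊G k' + k'⌋₊ < n + k' := (Nat.floor_lt (hH0 k')).2 (by push_cast; linarith)
    refine h3 ?_
    rw [hpf k ((hK k).2 ⟨hk, hlk⟩), hpf k' ((hK k').2 ⟨by omega, hlk'⟩)]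
    simp only [f, hH]
    omega

lemma card_filter_flat_steps (p : ℕ → ℕ) (hp : ∀ c, p c ≤ p (c + 1) ∧ p (c + 1) ≤ p c + 1)
    (k : ℕ) : ((Icc 1 k).filter fun c => p c = p (c - 1)).card + p k = k + p 0 := by
  induction k with
  | zero => simp
  | succ k ih =>
    rw [← Finset.insert_Icc_right_eq_Icc_add_one (by omega), filter_insert]
    have := hp k
    split_ifs with h
    · rw [card_insert_of_notMem (by simp)]
      simp only [Nat.add_sub_cancel] at h
      omega
    · simp only [Nat.add_sub_cancel] at h
      omega

lemma exists_mem_Ico_of_antitone {y : ℕ → ℝ} {m : ℕ} {t : ℝ} (h0 : t < y 0)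
    (hm : y (m + 1) ≤ t) : ∃ k ≤ m, t ∈ Set.Ico (y (k + 1)) (y k) := by
  induction m with
  | zero => exact ⟨0, le_rfl, hm, h0⟩
  | succ m ih =>
    by_cases h : y (m + 1) ≤ t
    · obtain ⟨k, hk, hkt⟩ := ih h
      exact ⟨k, by omega, hkt⟩
    · exact ⟨m + 1, le_rfl, hm, not_le.1 h⟩

lemma pairwise_disjoint_Ico_of_antitone {y : ℕ → ℝ} (hy : Antitone y) :
    Pairwise (Function.onFun Disjoint fun k => Set.Ico (y (k + 1)) (y k)) := by
  refine (pairwise_disjoint_on _).2 fun a b hab => ?_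
  rw [Set.disjoint_left]
  rintro t ⟨h1, _⟩ ⟨_, h2⟩
  have := hy (show a + 1 ≤ b by omega)
  linarith

lemma volume_real_iUnion_inter_Ico {y : ℕ → ℝ} (hy : Antitone y) {m : ℕ} (hm : y (m + 1) = 0)
    {B : ℕ → Set ℝ} (hB : ∀ k, MeasurableSet (B k)) (hBy : ∀ k, B k ⊆ Set.Ico (y (k + 1)) (y k))
    (c : ℕ) :
    volume.real ((⋃ k ∈ range (m + 1), B k) ∩ Set.Ico 0 (y c)) =
      ∑ k ∈ Ico c (m + 1), volume.real (B k) := by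
  have hset : (⋃ k ∈ range (m + 1), B k) ∩ Set.Ico 0 (y c) = ⋃ k ∈ Ico c (m + 1), B k := by
    ext t
    simp only [Set.mem_inter_iff, Set.mem_iUnion, mem_range, mem_Ico, exists_prop]
    constructor
    · rintro ⟨⟨k, hk, hkt⟩, h0, hc⟩
      refine ⟨k, ⟨?_, hk⟩, hkt⟩
      by_contra! hkc
      have := hy (show k + 1 ≤ c by omega)
      linarith [(hBy k hkt).1]
    · rintro ⟨k, ⟨hck, hk⟩, hkt⟩
      refine ⟨⟨k, hk, hkt⟩, ?_, (hBy k hkt).2.trans_le (hy hck)⟩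
      have := hy (show k + 1 ≤ m + 1 by omega)
      linarith [(hBy k hkt).1]
  rw [hset]
  refine measureReal_biUnion_finset (fun a _ b _ hab => ?_) (fun k _ => hB k) fun k _ => ?_
  · exact (pairwise_disjoint_Ico_of_antitone hy hab).mono (hBy a) (hBy b)
  · exact ((measure_mono (hBy k)).trans_lt (by simp)).ne

open Classical in
lemma exists_greedy_sets (n m : ℕ) (hn : 1 ≤ n) (y z : ℕ → ℝ) (hy : Antitone y)
    (hy0 : y 0 = 1) (hym : y (m + 1) = 0) (hy1 : y 1 < 1) (hypos : 0 < y m)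
    (hz : ∀ i < n, 0 ≤ z i ∧ z i ≤ 1) :
    ∃ (Y : ℕ → Set ℝ) (T : Finset ℕ) (α : ℕ),
      (∀ i, MeasurableSet (Y i)) ∧ (∀ i, Y i ⊆ Set.Ico 0 1) ∧
      (∀ i < n, volume.real (Y i) = z i) ∧ T ⊆ Icc 1 m ∧ T.card ≤ n - 1 ∧ α ≤ n - 1 ∧
      (∀ i < n, ∀ c ∈ Icc 1 m \ T,
        volume.real (Y i ∩ Set.Ico 0 (y c)) = max 0 (z i + y c - 1)) ∧
      ∀ t ∈ Set.Ico (0 : ℝ) 1,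
        ((range n).filter fun i => t ∈ Y i).card + (T.filter fun c => t < y c).card = α ∨
        ((range n).filter fun i => t ∈ Y i).card + (T.filter fun c => t < y c).card = α + 1 := by
  set l : ℕ → ℝ := fun k => y k - y (k + 1) with hl
  have hlnn : ∀ k, 0 ≤ l k := fun k => sub_nonneg.2 (hy (Nat.le_succ k))
  have hlsum : ∀ c, ∑ k ∈ range c, l k = 1 - y c := fun c => by
    simp only [hl, Finset.sum_range_sub', hy0]
  obtain ⟨g, p, hg, hgz, hp, hp0, hpm, hpG, hcross⟩ := exists_fractions_and_levels n m hn l z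
    (by rw [hlsum, hym, sub_zero]) (by simp [hl, hy0, hy1]) (by simp [hl, hym, hypos]) hz
  have hpmono : Monotone p := monotone_nat_of_le_succ fun c => (hp c).1
  let B : ℕ → ℕ → Set ℝ := fun i k => arcSet (y (k + 1)) (l k) (∑ j ∈ range i, g j k) (g i k)
  have hBsub : ∀ i k, B i k ⊆ Set.Ico (y (k + 1)) (y k) := fun i k => by
    simpa [hl] using arcSet_subset (y (k + 1)) (l k) (∑ j ∈ range i, g j k) (g i k)
  have hBmeas : ∀ i k, MeasurableSet (B i k) := fun i k => measurableSet_arcSet _ _ _ _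
  have hBvol : ∀ i k, volume.real (B i k) = l k * g i k := fun i k =>
    volume_real_arcSet (hlnn k) (hg i k).1 (hg i k).2
  let Y : ℕ → Set ℝ := fun i => ⋃ k ∈ range (m + 1), B i k
  have hYsub : ∀ i, Y i ⊆ Set.Ico 0 1 := by
    intro i t ht
    simp only [Y, Set.mem_iUnion, mem_range, exists_prop] at ht
    obtain ⟨k, hk, hkt⟩ := ht
    have h1 := hBsub i k hkt
    have h2 := hy (show k + 1 ≤ m + 1 by omega)
    have h3 := hy (Nat.zero_le k)
    exact ⟨by linarith [h1.1], by linarith [h1.2]⟩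
  have hYvol : ∀ i c, volume.real (Y i ∩ Set.Ico 0 (y c)) =
      ∑ k ∈ Ico c (m + 1), l k * g i k := fun i c => by
    simp only [← hBvol]
    exact volume_real_iUnion_inter_Ico hy hym (hBmeas i) (hBsub i) c
  refine ⟨Y, (Icc 1 m).filter fun c => p c = p (c - 1), p 0,
    fun i => Finset.measurableSet_biUnion _ fun k _ => hBmeas i k, hYsub, fun i hi => ?_,
    filter_subset _ _, ?_, hp0, fun i hi c hc => ?_, fun t ht => ?_⟩
  · have h := hYvol i 0
    rw [hy0, Set.inter_eq_left.2 (hYsub i), ← Finset.range_eq_Ico, hgz i hi] at h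
    exact h
  · have := card_filter_flat_steps p hp m
    omega
  · simp only [mem_sdiff, mem_filter, not_and, mem_Icc] at hc
    have hpc : p (c - 1) ≠ p c := fun h => hc.2 hc.1 h.symm
    have hsplit := Finset.sum_range_add_sum_Ico (fun k => l k * g i k) (show c ≤ m + 1 by omega)
    rw [hgz i hi] at hsplit
    rw [hYvol]
    by_cases hall : ∀ k ∈ Ico c (m + 1), l k * g i k = 0
    · rw [Finset.sum_eq_zero hall] at hsplit ⊢
      have : ∑ k ∈ range c, l k * g i k ≤ ∑ k ∈ range c, l k :=
        Finset.sum_le_sum fun k _ => mul_le_of_le_one_right (hlnn k) (hg i k).2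
      rw [hlsum] at this
      rw [max_eq_left (by linarith)]
    · push Not at hall
      obtain ⟨k, hk, hne⟩ := hall
      rw [mem_Ico] at hk
      obtain ⟨hlk, hgk⟩ := mul_ne_zero_iff.1 hne
      have hlow : ∑ k' ∈ range c, l k' * g i k' = ∑ k' ∈ range c, l k' := by
        refine Finset.sum_congr rfl fun k' hk' => ?_
        rw [mem_range] at hk'
        rcases (hlnn k').eq_or_lt with h | h
        · simp [← h]
        · rcases hcross i hi k' k (by omega) (by omega) ((hlnn k).lt_of_ne' hlk) h with h' | h' | h'
          · exact absurd h' hgk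
          · rw [h', mul_one]
          · have h1 := hpmono (show k' ≤ c - 1 by omega)
            have h2 := hpmono (show c - 1 ≤ c by omega)
            have h3 := hpmono (show c ≤ k by omega)
            omega
      rw [hlow, hlsum] at hsplit
      have : 0 ≤ ∑ k ∈ Ico c (m + 1), l k * g i k :=
        Finset.sum_nonneg fun k _ => mul_nonneg (hlnn k) (hg i k).1
      rw [max_eq_right (by linarith)]
      linarith
  · obtain ⟨k, hk, hkt⟩ := exists_mem_Ico_of_antitone (y := y) (m := m) (t := t)
      (by rw [hy0]; exact ht.2) (by rw [hym]; exact ht.1)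
    have hlk : 0 < l k := by simp only [hl]; linarith [hkt.1, hkt.2]
    have hkt' : t ∈ Set.Ico (y (k + 1)) (y (k + 1) + l k) := by simpa [hl] using hkt
    have hmem : ∀ i, t ∈ Y i ↔ t ∈ B i k := by
      intro i
      simp only [Y, Set.mem_iUnion, mem_range, exists_prop]
      refine ⟨fun ⟨k', _, h⟩ => ?_, fun h => ⟨k, by omega, h⟩⟩
      have : k' = k := by
        by_contra hne
        exact Set.disjoint_left.1 (pairwise_disjoint_Ico_of_antitone hy hne) (hBsub i k' h) hkt
      exact this ▸ h
    have hcount := card_filter_mem_arcSet (fun i => g i k) (fun i => hg i k) hkt' n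
    have hlt : ∀ c, t < y c ↔ c ≤ k := by
      intro c
      refine ⟨fun h => ?_, fun h => hkt.2.trans_le (hy h)⟩
      by_contra! hck
      have := hy (show k + 1 ≤ c by omega)
      linarith [hkt.1]
    have hT : (((Icc 1 m).filter fun c => p c = p (c - 1)).filter fun c => t < y c) =
        (Icc 1 k).filter fun c => p c = p (c - 1) := by
      ext c
      simp only [mem_filter, mem_Icc, hlt]
      constructor
      · rintro ⟨⟨⟨h1, _⟩, h2⟩, h3⟩
        exact ⟨⟨h1, h3⟩, h2⟩
      · rintro ⟨⟨h1, h3⟩, h2⟩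
        exact ⟨⟨⟨h1, by omega⟩, h2⟩, h3⟩
    rw [hT]
    simp only [hmem]
    have hsteps := card_filter_flat_steps p hp k
    obtain ⟨hG1, hG2⟩ := hpG k hk hlk
    have hu0 : 0 ≤ (t - y (k + 1)) / l k := div_nonneg (by linarith [hkt.1]) hlk.le
    have hu1 : (t - y (k + 1)) / l k < 1 := by
      rw [div_lt_one hlk]; linarith [hkt'.2]
    have hc1 : ((p k : ℤ) - k) ≤ ⌈∑ i ∈ range n, g i k - (t - y (k + 1)) / l k⌉ := by
      rw [Int.le_ceil_iff]
      push_cast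
      linarith
    have hc2 : ⌈∑ i ∈ range n, g i k - (t - y (k + 1)) / l k⌉ ≤ (p k : ℤ) - k + 1 := by
      rw [Int.ceil_le]
      push_cast
      linarith
    rw [← hcount] at hc1 hc2
    simp only [B]
    omega

open Classical in
/-- Greedy construction for complete split graphs: given decreasing `x` on the clique
`V1 = {1,…,n1}` and on the independent set `V2 = {n1+1,…,n}`, with `X_j = [0, x_j)` for
`j ∈ V2`, there are sets `X_i` for `i ∈ V1`, a set `S ⊆ V2` with `|S| ≤ n1 - 1` and an
integer `0 ≤ α ≤ n1 - 1` such that (a) `μ(X_i ∩ X_j) = max{0, x_i + x_j - 1}` for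
`i ∈ V1`, `j ∈ V2 ∖ S`, and (b) every `t ∈ [0,1)` lies in either `α` or `α + 1` of the
sets `X_i`, `i ∈ V1 ∪ S`. -/
theorem split_graph_greedy_construction (n1 n2 : ℕ) (h1 : 1 ≤ n1) (h2 : 1 ≤ n2)
    (x : ℕ → ℝ)
    (hx1 : ∀ i ∈ Finset.Icc 1 n1, 0 < x i ∧ x i < 1)
    (hmono1 : ∀ i ∈ Finset.Icc 1 n1, ∀ j ∈ Finset.Icc 1 n1, i ≤ j → x j ≤ x i)
    (hx2 : ∀ i ∈ Finset.Icc (n1 + 1) (n1 + n2), 0 < x i ∧ x i < 1)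
    (hmono2 : ∀ i ∈ Finset.Icc (n1 + 1) (n1 + n2), ∀ j ∈ Finset.Icc (n1 + 1) (n1 + n2),
      i ≤ j → x j ≤ x i) :
    ∃ (X : ℕ → Set ℝ) (S : Finset ℕ) (α : ℕ),
      (∀ j ∈ Finset.Icc (n1 + 1) (n1 + n2), X j = Set.Ico 0 (x j)) ∧
      (∀ i ∈ Finset.Icc 1 n1, MeasurableSet (X i)) ∧
      (∀ i ∈ Finset.Icc 1 n1, X i ⊆ Set.Ico 0 1) ∧
      (∀ i ∈ Finset.Icc 1 n1, (volume (X i)).toReal = x i) ∧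
      S ⊆ Finset.Icc (n1 + 1) (n1 + n2) ∧ S.card ≤ n1 - 1 ∧ α ≤ n1 - 1 ∧
      (∀ i ∈ Finset.Icc 1 n1, ∀ j ∈ Finset.Icc (n1 + 1) (n1 + n2) \ S,
        (volume (X i ∩ X j)).toReal = max 0 (x i + x j - 1)) ∧
      (∀ t ∈ Set.Ico (0 : ℝ) 1,
        ((Finset.Icc 1 n1 ∪ S).filter (fun i => t ∈ X i)).card = α ∨
          ((Finset.Icc 1 n1 ∪ S).filter (fun i => t ∈ X i)).card = α + 1) := by
  let y : ℕ → ℝ := fun c => if c = 0 then 1 else if c ≤ n2 then x (n1 + c) else 0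
  have hyx : ∀ c, 1 ≤ c → c ≤ n2 → y c = x (n1 + c) := fun c hc hc' => by
    simp [y, hc', show c ≠ 0 by omega]
  have hx2' : ∀ c, 1 ≤ c → c ≤ n2 → 0 < x (n1 + c) ∧ x (n1 + c) < 1 := fun c hc hc' =>
    hx2 _ (by rw [mem_Icc]; omega)
  have hy : Antitone y := by
    refine antitone_nat_of_succ_le fun c => ?_
    by_cases hc : c + 1 ≤ n2
    · rw [hyx (c + 1) (by omega) hc]
      by_cases hc0 : c = 0
      · subst hc0
        simpa [y] using (hx2' 1 le_rfl h2).2.le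
      · rw [hyx c (by omega) (by omega)]
        exact hmono2 _ (by rw [mem_Icc]; omega) _ (by rw [mem_Icc]; omega) (by omega)
    · have : y (c + 1) = 0 := by simp [y]; omega
      rw [this]
      simp only [y]
      split_ifs with h h'
      · exact zero_le_one
      · exact (hx2' c (by omega) h').1.le
      · exact le_rfl
  obtain ⟨Y, T, α, hYm, hYs, hYv, hT, hTc, hα, ha, hb⟩ :=
    exists_greedy_sets n1 n2 h1 y (fun i => x (i + 1)) hy (by simp [y]) (by simp [y])
      (by rw [hyx 1 le_rfl h2]; exact (hx2' 1 le_rfl h2).2)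
      (by rw [hyx n2 h2 le_rfl]; exact (hx2' n2 h2 le_rfl).1)
      (fun i hi => by
        have := hx1 (i + 1) (by rw [mem_Icc]; omega)
        exact ⟨this.1.le, this.2.le⟩)
  let X : ℕ → Set ℝ := fun j => if j ≤ n1 then Y (j - 1) else Set.Ico 0 (x j)
  have hX1 : ∀ i < n1, X (i + 1) = Y i := fun i hi => by simp [X, Nat.succ_le_iff.2 hi]
  have hX2 : ∀ c, 1 ≤ c → X (n1 + c) = Set.Ico 0 (x (n1 + c)) := fun c hc => by
    simp [X, show c ≠ 0 by omega]
  have hV1 : ∀ i ∈ Icc 1 n1, ∃ i' < n1, i = i' + 1 := fun i hi => by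
    rw [mem_Icc] at hi
    exact ⟨i - 1, by omega, by omega⟩
  have hV2 : ∀ j ∈ Icc (n1 + 1) (n1 + n2), ∃ c ∈ Icc 1 n2, j = n1 + c := fun j hj => by
    rw [mem_Icc] at hj
    exact ⟨j - n1, by rw [mem_Icc]; omega, by omega⟩
  have hV1eq : Icc 1 n1 = (range n1).image (· + 1) := by
    ext i
    simp only [mem_Icc, mem_image, mem_range]
    exact ⟨fun h => ⟨i - 1, by omega, by omega⟩, fun ⟨a, h, h'⟩ => by omega⟩
  refine ⟨X, T.image (n1 + ·), α, ?_, ?_, ?_, ?_, ?_, ?_, hα, ?_, ?_⟩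
  · intro j hj
    obtain ⟨c, hc, rfl⟩ := hV2 j hj
    exact hX2 c (mem_Icc.1 hc).1
  · intro i hi
    obtain ⟨i, hi', rfl⟩ := hV1 i hi
    rw [hX1 i hi']
    exact hYm i
  · intro i hi
    obtain ⟨i, hi', rfl⟩ := hV1 i hi
    rw [hX1 i hi']
    exact hYs i
  · intro i hi
    obtain ⟨i, hi', rfl⟩ := hV1 i hi
    rw [hX1 i hi']
    exact hYv i hi'
  · intro j hj
    obtain ⟨c, hc, rfl⟩ := mem_image.1 hj
    have := mem_Icc.1 (hT hc)
    rw [mem_Icc]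
    omega
  · exact card_image_le.trans hTc
  · intro i hi j hj
    rw [mem_sdiff] at hj
    obtain ⟨i, hi', rfl⟩ := hV1 i hi
    obtain ⟨c, hc, rfl⟩ := hV2 j hj.1
    have hcT : c ∉ T := fun h => hj.2 (mem_image_of_mem _ h)
    have hc' := mem_Icc.1 hc
    have := ha i hi' c (mem_sdiff.2 ⟨hc, hcT⟩)
    rw [hyx c hc'.1 hc'.2] at this
    rw [hX1 i hi', hX2 c hc'.1]
    exact this
  · intro t ht
    have hcard : ((Icc 1 n1 ∪ T.image (n1 + ·)).filter fun i => t ∈ X i).card =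
        ((range n1).filter fun i => t ∈ Y i).card + (T.filter fun c => t < y c).card := by
      rw [filter_union, card_union_of_disjoint, hV1eq, filter_image, filter_image,
        card_image_of_injective _ (add_left_injective 1),
        card_image_of_injective _ (add_right_injective n1)]
      · congr 2
        · refine filter_congr fun i hi => ?_
          rw [hX1 i (mem_range.1 hi)]
        · refine filter_congr fun c hc => ?_
          have hc' := mem_Icc.1 (hT hc)
          rw [hX2 c hc'.1, hyx c hc'.1 hc'.2]
          exact ⟨fun h => h.2, fun h => ⟨ht.1, h⟩⟩
      · refine disjoint_filter_filter (disjoint_left.2 fun i hi hi' => ?_)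
        obtain ⟨c, hc, rfl⟩ := mem_image.1 hi'
        have := mem_Icc.1 (hT hc)
        rw [mem_Icc] at hi
        omega
    rw [hcard]
    exact hb t ht
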